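/- There exists an absolute constant C > 0 such that for all integers 4 ≤ k ≤ n with n ≥ 2 and every real 1 < δ ≤ 2, there exists a δ-balanced (n,k)-family of perfect hash functions of size at most 2^{C·k·log log k}·(δ−1)^{−C·log k}·log n. In particular, for any fixed 1 < δ ≤ 2 the size is 2^{O(k log log k)}·log n. -/

import Mathlib

open Finset

attribute [local instance] Classical.propDecidable

/-- The number of functions in the family `F` that are injective on the set `S`. -/
noncomputable def injCount {n k N : ℕ} (F : Fin N → Fin n → Fin k) (S : Finset (Fin n)) : ℕ :=
  (Finset.univ.filter fun i => Set.InjOn (F i) ↑S).card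

/-- `F` is a `δ`-balanced `(n,k)`-family of perfect hash functions. -/
noncomputable def IsBalancedFamily {n k N : ℕ} (δ : ℝ) (F : Fin N → Fin n → Fin k) : Prop :=
  ∃ T : ℝ, 0 < T ∧ ∀ S : Finset (Fin n), S.card = k →
    T / δ ≤ (injCount F S : ℝ) ∧ (injCount F S : ℝ) ≤ δ * T

section Concentration

variable {Ω : Type*} [Fintype Ω]

theorem sum_exp_mul_card_filter_le (P : Ω → Prop) {p : ℝ}
    (hp : ((univ.filter P).card : ℝ) = p * Fintype.card Ω) (N : ℕ) (t : ℝ) :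
    ∑ F : Fin N → Ω, Real.exp (t * ((univ.filter fun i => P (F i)).card : ℝ)) ≤
      (Fintype.card Ω : ℝ) ^ N * Real.exp (p * N * (Real.exp t - 1)) := by
  have hprod : ∀ F : Fin N → Ω,
      Real.exp (t * ((univ.filter fun i => P (F i)).card : ℝ)) =
        ∏ i, if P (F i) then Real.exp t else 1 := by
    intro F
    rw [Finset.prod_ite, Finset.prod_const, Finset.prod_const_one, mul_one, ← Real.exp_nat_mul,
      mul_comm]
  have hsum : ∑ ω : Ω, (if P ω then Real.exp t else 1) =
      Fintype.card Ω * (1 + p * (Real.exp t - 1)) := by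
    have h : ∀ ω : Ω, (if P ω then Real.exp t else 1) =
        1 + (if P ω then Real.exp t - 1 else 0) := by
      intro ω; split_ifs <;> ring
    rw [Finset.sum_congr rfl fun ω _ => h ω, Finset.sum_add_distrib, ← Finset.sum_filter,
      Finset.sum_const, Finset.sum_const, nsmul_eq_mul, nsmul_eq_mul, hp, Finset.card_univ]
    ring
  have hnonneg : 0 ≤ (Fintype.card Ω : ℝ) * (1 + p * (Real.exp t - 1)) := by
    rw [← hsum]
    exact Finset.sum_nonneg fun ω _ => by split_ifs <;> positivity
  rw [Finset.sum_congr rfl fun F _ => hprod F,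
    ← Fintype.sum_pow (fun ω => if P ω then Real.exp t else 1) N, hsum]
  calc ((Fintype.card Ω : ℝ) * (1 + p * (Real.exp t - 1))) ^ N
      ≤ ((Fintype.card Ω : ℝ) * Real.exp (p * (Real.exp t - 1))) ^ N := by
        gcongr
        linarith [Real.add_one_le_exp (p * (Real.exp t - 1))]
    _ = _ := by
        rw [mul_pow, ← Real.exp_nat_mul]
        congr 2
        ring

theorem sq_div_eight_le_mul_log_sub {δ : ℝ} (h₁ : 1 < δ) (h₂ : δ ≤ 2) :
    (δ - 1) ^ 2 / 8 ≤ δ * Real.log δ - (δ - 1) := by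
  have h := Real.le_log_one_add_of_nonneg (x := δ - 1) (by linarith)
  rw [add_sub_cancel, div_le_iff₀ (by linarith)] at h
  nlinarith [mul_pos (sub_pos.2 h₁) (sub_pos.2 h₁)]

theorem sq_div_eight_le_sub_log_div {δ : ℝ} (h₁ : 1 < δ) (h₂ : δ ≤ 2) :
    (δ - 1) ^ 2 / 8 ≤ (1 - δ⁻¹) - δ⁻¹ * Real.log δ := by
  have hδ : 0 < δ := by linarith
  have hlog : Real.log δ ≤ (δ - 1) - (δ - 1) ^ 2 / 4 := by
    rw [Real.log_le_iff_le_exp hδ]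
    have hx : 3 / 4 * (δ - 1) ≤ (δ - 1) - (δ - 1) ^ 2 / 4 := by nlinarith
    have := Real.quadratic_le_exp_of_nonneg (x := (δ - 1) - (δ - 1) ^ 2 / 4) (by linarith)
    nlinarith [mul_self_le_mul_self (by linarith) hx]
  have heq : (1 - δ⁻¹) - δ⁻¹ * Real.log δ = ((δ - 1) - Real.log δ) / δ := by
    field_simp
  rw [heq, le_div_iff₀ hδ]
  nlinarith [sq_nonneg (δ - 1)]

theorem exists_forall_card_filter_mem_Icc {ι : Type*} [Fintype ι] (P : ι → Ω → Prop) {p δ : ℝ}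
    (hp₀ : 0 ≤ p) (hp : ∀ s, ((univ.filter (P s)).card : ℝ) = p * Fintype.card Ω) {N : ℕ}
    (h₁ : 1 < δ) (h₂ : δ ≤ 2) (hΩ : 0 < Fintype.card Ω)
    (hN : 2 * (Fintype.card ι : ℝ) * Real.exp (-(p * N * ((δ - 1) ^ 2 / 8))) < 1) :
    ∃ F : Fin N → Ω, ∀ s,
      p * N / δ ≤ ((univ.filter fun i => P s (F i)).card : ℝ) ∧
      ((univ.filter fun i => P s (F i)).card : ℝ) ≤ δ * (p * N) := by
  have hδ : 0 < δ := by linarith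
  have hL : 0 < Real.log δ := Real.log_pos h₁
  have hpN : 0 ≤ p * N := by positivity
  set L := Real.log δ with hLdef
  set X : ι → (Fin N → Ω) → ℝ := fun s F => ((univ.filter fun i => P s (F i)).card : ℝ) with hX
  set E := Real.exp (-(p * N * ((δ - 1) ^ 2 / 8))) with hE
  set M : ℝ := (Fintype.card Ω : ℝ) ^ N with hM
  have hMpos : 0 < M := by positivity
  have upper : ∀ s, ∑ F, Real.exp (L * X s F - L * (δ * (p * N))) ≤ M * E := by
    intro s
    have h := sum_exp_mul_card_filter_le (P s) (hp s) N L
    rw [hLdef, Real.exp_log hδ, ← hLdef] at h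
    simp only [Real.exp_sub, ← Finset.sum_div]
    rw [div_le_iff₀ (Real.exp_pos _)]
    refine h.trans ?_
    rw [hE, mul_assoc M, ← Real.exp_add]
    gcongr
    nlinarith [mul_le_mul_of_nonneg_left (sq_div_eight_le_mul_log_sub h₁ h₂) hpN]
  have lower : ∀ s, ∑ F, Real.exp (-L * X s F + L * (p * N / δ)) ≤ M * E := by
    intro s
    have h := sum_exp_mul_card_filter_le (P s) (hp s) N (-L)
    rw [Real.exp_neg, hLdef, Real.exp_log hδ, ← hLdef] at h
    simp only [Real.exp_add, ← Finset.sum_mul]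
    refine (mul_le_mul_of_nonneg_right h (Real.exp_pos _).le).trans ?_
    rw [mul_assoc, hE, ← Real.exp_add]
    gcongr
    have := mul_le_mul_of_nonneg_left (sq_div_eight_le_sub_log_div h₁ h₂) hpN
    rw [div_eq_mul_inv]
    nlinarith
  set Φ : (Fin N → Ω) → ℝ := fun F =>
    ∑ s, (Real.exp (L * X s F - L * (δ * (p * N))) + Real.exp (-L * X s F + L * (p * N / δ)))
    with hΦ
  obtain ⟨F, -, hF⟩ : ∃ F ∈ (univ : Finset (Fin N → Ω)), Φ F < 1 := by
    refine Finset.exists_lt_of_sum_lt ?_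
    calc ∑ F, Φ F ≤ ∑ _s : ι, 2 * (M * E) := by
          rw [hΦ, Finset.sum_comm]
          refine Finset.sum_le_sum fun s _ => ?_
          rw [Finset.sum_add_distrib]
          linarith [upper s, lower s]
      _ = M * (2 * (Fintype.card ι : ℝ) * E) := by
          rw [Finset.sum_const, nsmul_eq_mul, Finset.card_univ]; ring
      _ < M * 1 := by gcongr
      _ = ∑ _F : Fin N → Ω, (1 : ℝ) := by simp [hM]
  refine ⟨F, fun s => ?_⟩
  have hs : Real.exp (L * X s F - L * (δ * (p * N))) +
      Real.exp (-L * X s F + L * (p * N / δ)) < 1 :=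
    (Finset.single_le_sum (f := fun s => Real.exp (L * X s F - L * (δ * (p * N))) +
      Real.exp (-L * X s F + L * (p * N / δ))) (fun _ _ => by positivity)
      (Finset.mem_univ s)).trans_lt hF
  have hu := Real.exp_lt_one_iff.1 ((le_add_of_nonneg_right (Real.exp_pos _).le).trans_lt hs)
  have hl := Real.exp_lt_one_iff.1 ((le_add_of_nonneg_left (Real.exp_pos _).le).trans_lt hs)
  constructor
  · exact le_of_mul_le_mul_left (by linarith) hL
  · exact le_of_mul_le_mul_left (by linarith) hL

end Concentration

theorem card_filter_injOn {n k : ℕ} (S : Finset (Fin n)) (hS : S.card = k) :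
    ((univ : Finset (Fin n → Fin k)).filter fun f => Set.InjOn f ↑S).card =
      k.factorial * k ^ (n - k) := by
  let e : {f : Fin n → Fin k // Set.InjOn f ↑S} ≃
      (S ↪ Fin k) × ({x // x ∉ S} → Fin k) :=
    ((Equiv.piEquivPiSubtypeProd (· ∈ S) fun _ => Fin k).subtypeEquiv
        (q := fun g => Function.Injective g.1) fun f => Set.injOn_iff_injective).trans
      ((Equiv.prodSubtypeFstEquivSubtypeProd (p := Function.Injective)).trans
        ((Equiv.subtypeInjectiveEquivEmbedding _ _).prodCongr (Equiv.refl _)))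
  rw [← Fintype.card_subtype, Fintype.card_congr e, Fintype.card_prod, Fintype.card_embedding_eq,
    Fintype.card_fun, Fintype.card_coe, Fintype.card_fin, hS, Nat.descFactorial_self,
    Fintype.card_subtype_compl, Fintype.card_fin, Fintype.card_coe, hS]

theorem exists_isBalancedFamily {n k N : ℕ} (hk : 0 < k) (hkn : k ≤ n) {δ : ℝ} (h₁ : 1 < δ)
    (h₂ : δ ≤ 2)
    (hN : 8 * (k + 1) * Real.log n * Real.exp k / (δ - 1) ^ 2 < N) (hn : 2 ≤ n) :
    ∃ F : Fin N → Fin n → Fin k, IsBalancedFamily δ F := by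
  set p : ℝ := k.factorial / (k : ℝ) ^ k with hp
  have hppos : 0 < p := by positivity
  have hpexp : 1 ≤ p * Real.exp k := by
    have h := Real.pow_div_factorial_le_exp (k : ℝ) (by positivity) k
    calc (1 : ℝ) = p * ((k : ℝ) ^ k / k.factorial) := by rw [hp]; field_simp
      _ ≤ _ := by gcongr
  have hlog : 0 < Real.log n := Real.log_pos (by exact_mod_cast hn)
  have hδ : 0 < (δ - 1) ^ 2 := by have := sub_pos.2 h₁; positivity
  have hNpos : (0 : ℝ) < N := lt_of_le_of_lt (by positivity) hN
  have hexponent : (k + 1) * Real.log n < p * N * ((δ - 1) ^ 2 / 8) := by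
    rw [div_lt_iff₀ hδ] at hN
    have h3 := mul_lt_mul_of_pos_left hN hppos
    nlinarith [mul_le_mul_of_nonneg_left hpexp
      (show 0 ≤ 8 * ((k : ℝ) + 1) * Real.log n by positivity)]
  obtain ⟨F, hF⟩ := exists_forall_card_filter_mem_Icc (N := N) (p := p)
    (fun (S : {S : Finset (Fin n) // S.card = k}) (f : Fin n → Fin k) => Set.InjOn f ↑S.1)
    hppos.le (fun S => by
      trans ((k.factorial * k ^ (n - k) : ℕ) : ℝ)
      · rw [← card_filter_injOn S.1 S.2]
        congr!
      rw [Fintype.card_fun, Fintype.card_fin, Fintype.card_fin, hp]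
      push_cast
      rw [div_mul_eq_mul_div, eq_div_iff (by positivity), mul_assoc, ← pow_add,
        Nat.sub_add_cancel hkn]) h₁ h₂
    (by rw [Fintype.card_fun, Fintype.card_fin]; positivity) (by
      rw [Fintype.card_finset_len, Fintype.card_fin]
      have hn2 : (2 : ℝ) ≤ n := by exact_mod_cast hn
      have hchoose : (n.choose k : ℝ) ≤ (n : ℝ) ^ k := by exact_mod_cast Nat.choose_le_pow n k
      calc 2 * (n.choose k : ℝ) * Real.exp (-(p * N * ((δ - 1) ^ 2 / 8)))
          ≤ n * (n : ℝ) ^ k * Real.exp (-(p * N * ((δ - 1) ^ 2 / 8))) := by gcongr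
        _ < n * (n : ℝ) ^ k * Real.exp (-((k + 1) * Real.log n)) := by gcongr
        _ = 1 := by
          rw [Real.exp_neg, show ((k : ℝ) + 1) * Real.log n = ((k + 1 : ℕ) : ℝ) * Real.log n by
            push_cast; ring, Real.exp_nat_mul, Real.exp_log (by positivity), ← pow_succ']
          exact mul_inv_cancel₀ (by positivity))
  exact ⟨F, p * N, by positivity, fun S hS => by
    convert hF ⟨S, hS⟩ using 3 <;> unfold injCount <;> congr!⟩

theorem sixteen_mul_succ_le_four_pow {k : ℕ} (hk : 4 ≤ k) : 16 * (k + 1) ≤ 4 ^ k := by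
  induction k, hk using Nat.le_induction with
  | base => norm_num
  | succ m _ ih => rw [pow_succ]; omega

theorem size_bound {n k : ℕ} (hk : 4 ≤ k) (hn : 2 ≤ n) {δ : ℝ} (h₁ : 1 < δ) (h₂ : δ ≤ 2) :
    16 * (k + 1) * Real.log n * Real.exp k / (δ - 1) ^ 2 ≤
      2 ^ (4 * (k : ℝ) * Real.logb 2 (Real.logb 2 k)) *
        (δ - 1) ^ (-(4 * Real.logb 2 k)) * Real.logb 2 n := by
  have hε : 0 < δ - 1 := sub_pos.2 h₁
  have hlog : 0 < Real.log n := Real.log_pos (by exact_mod_cast hn)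
  have hk4 : (4 : ℝ) ≤ k := by exact_mod_cast hk
  have hlogk : 2 ≤ Real.logb 2 k := by
    rw [Real.le_logb_iff_rpow_le (by norm_num) (by linarith)]
    exact le_trans (by norm_num) hk4
  have hloglogk : 1 ≤ Real.logb 2 (Real.logb 2 k) := by
    rw [Real.le_logb_iff_rpow_le (by norm_num) (by linarith)]
    simpa using hlogk
  have hlogn : Real.log n ≤ Real.logb 2 n := by
    rw [Real.logb, le_div_iff₀ (Real.log_pos (by norm_num))]
    nlinarith [Real.log_two_lt_d9]
  have hexp : Real.exp k ≤ 4 ^ k := by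
    rw [← mul_one (k : ℝ), Real.exp_nat_mul]
    gcongr
    linarith [Real.exp_one_lt_d9]
  have hlin : 16 * ((k : ℝ) + 1) ≤ 4 ^ k := by exact_mod_cast sixteen_mul_succ_le_four_pow hk
  have htwo : (4 : ℝ) ^ k * 4 ^ k ≤ 2 ^ (4 * (k : ℝ) * Real.logb 2 (Real.logb 2 k)) := by
    calc (4 : ℝ) ^ k * 4 ^ k = 2 ^ (4 * (k : ℝ)) := by
          rw [← mul_pow, Real.rpow_mul (by norm_num), Real.rpow_natCast]
          norm_num
      _ ≤ _ := by
          refine Real.rpow_le_rpow_of_exponent_le (by norm_num) ?_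
          nlinarith
  have hδpow : ((δ - 1) ^ 2)⁻¹ ≤ (δ - 1) ^ (-(4 * Real.logb 2 k)) := by
    rw [← Real.rpow_natCast, ← Real.rpow_neg hε.le]
    refine Real.rpow_le_rpow_of_exponent_ge hε (by linarith) ?_
    push_cast
    linarith
  calc 16 * (k + 1) * Real.log n * Real.exp k / (δ - 1) ^ 2
      = (16 * (k + 1)) * Real.exp k * ((δ - 1) ^ 2)⁻¹ * Real.log n := by ring
    _ ≤ 4 ^ k * 4 ^ k * (δ - 1) ^ (-(4 * Real.logb 2 k)) * Real.logb 2 n := by gcongr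
    _ ≤ _ := by
      have : 0 ≤ Real.logb 2 n := hlog.le.trans hlogn
      gcongr

/-- main result: there is an absolute constant `C > 0` such that for all
`4 ≤ k ≤ n` with `n ≥ 2` and every `1 < δ ≤ 2`, there exists a `δ`-balanced `(n,k)`-family
of perfect hash functions of size at most
`2^{C·k·log₂ log₂ k}·(δ−1)^{−C·log₂ k}·log₂ n`. -/
theorem stmt10 :
    ∃ C : ℝ, 0 < C ∧ ∀ n k : ℕ, 4 ≤ k → k ≤ n → 2 ≤ n →
      ∀ δ : ℝ, 1 < δ → δ ≤ 2 →
        ∃ (N : ℕ) (F : Fin N → Fin n → Fin k),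
          IsBalancedFamily δ F ∧
          (N : ℝ) ≤ 2 ^ (C * (k : ℝ) * Real.logb 2 (Real.logb 2 k)) *
            (δ - 1) ^ (-(C * Real.logb 2 k)) * Real.logb 2 n := by
  refine ⟨4, by norm_num, fun n k hk hkn hn δ h₁ h₂ => ?_⟩
  set x : ℝ := 8 * (k + 1) * Real.log n * Real.exp k / (δ - 1) ^ 2 with hx
  obtain ⟨F, hF⟩ := exists_isBalancedFamily (N := ⌊x⌋₊ + 1) (by omega) hkn h₁ h₂
    (by rw [← hx]; push_cast; exact Nat.lt_floor_add_one x) hn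
  refine ⟨_, F, hF, le_trans ?_ (size_bound hk hn h₁ h₂)⟩
  have hε : 0 < δ - 1 := sub_pos.2 h₁
  have hlog : 1 / 2 ≤ Real.log n := by
    have : Real.log 2 ≤ Real.log n := Real.log_le_log (by norm_num) (by exact_mod_cast hn)
    linarith [Real.log_two_gt_d9]
  have hexp : 1 ≤ Real.exp k := Real.one_le_exp (by positivity)
  have hx1 : 1 ≤ x := by
    rw [hx, one_le_div (by positivity)]
    calc (δ - 1) ^ 2 ≤ 1 := pow_le_one₀ hε.le (by linarith)
      _ ≤ 8 * (0 + 1) * (1 / 2) * 1 := by norm_num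
      _ ≤ 8 * (k + 1) * Real.log n * Real.exp k := by gcongr; positivity
  have hfloor : (⌊x⌋₊ : ℝ) ≤ x := Nat.floor_le (by linarith)
  calc ((⌊x⌋₊ + 1 : ℕ) : ℝ) ≤ 2 * x := by push_cast; linarith
    _ = _ := by rw [hx]; ring
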